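/- Let M_n = 2^n·(3n)! / ((n+1)!·(2n+1)!). Then the series ∑_{n≥0} n·M_n·(2/27)^n is summable, while the series ∑_{n≥0} n²·M_n·(2/27)^n is not summable; that is, at the critical point of the triple-scaled 2PI generating function, the expectation value of the genus remains finite but its variance diverges. -/

import Mathlib

/-- `M_n = 2^n·(3n)!/((n+1)!·(2n+1)!)`, the number of rooted bridgeless planar cubic
maps with `2n` vertices. -/
noncomputable def cubicMapCount (n : ℕ) : ℝ :=
  (2 : ℝ) ^ n * (Nat.factorial (3 * n)) /
    (Nat.factorial (n + 1) * Nat.factorial (2 * n + 1))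

lemma cmc_rec (n : ℕ) : 9 * ((n : ℝ) + 2) * (2 * n + 3) * (cubicMapCount (n + 1) * (2 / 27) ^ (n + 1))
    = 2 * (3 * n + 1) * (3 * n + 2) * (cubicMapCount n * (2 / 27) ^ n) := by
  unfold cubicMapCount
  have h1 : 3 * (n + 1) = 3 * n + 1 + 1 + 1 := by ring
  have h2 : 2 * (n + 1) + 1 = 2 * n + 1 + 1 + 1 := by ring
  rw [h1, h2, Nat.factorial_succ (3 * n + 1 + 1), Nat.factorial_succ (3 * n + 1),
    Nat.factorial_succ (3 * n), Nat.factorial_succ (2 * n + 1 + 1), Nat.factorial_succ (2 * n + 1),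
    Nat.factorial_succ (n + 1)]
  have e1 : ((n + 1).factorial : ℝ) ≠ 0 := by positivity
  have e2 : ((2 * n + 1).factorial : ℝ) ≠ 0 := by positivity
  have e3 : (n : ℝ) + 1 + 1 ≠ 0 := by positivity
  have e4 : 2 * (n : ℝ) + 1 + 1 ≠ 0 := by positivity
  have e5 : 2 * (n : ℝ) + 1 + 1 + 1 ≠ 0 := by positivity
  push_cast
  rw [pow_succ, pow_succ]
  generalize ((n + 1).factorial : ℝ) = A at *
  generalize ((2 * n + 1).factorial : ℝ) = B at *
  generalize ((3 * n).factorial : ℝ) = C at *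
  generalize (2 : ℝ) ^ n = D at *
  generalize (2 / 27 : ℝ) ^ n = E at *
  field_simp
  ring

lemma cmc_nonneg (n : ℕ) : 0 ≤ cubicMapCount n * (2 / 27) ^ n := by
  unfold cubicMapCount; positivity

lemma cmc_succ (n : ℕ) :
    ((n : ℝ) + 2) * (2 * n + 3) * (cubicMapCount (n + 1) * (2 / 27) ^ (n + 1))
    = (2 * n ^ 2 + 2 * n + 4 / 9) * (cubicMapCount n * (2 / 27) ^ n) := by
  linear_combination (1 / 9) * cmc_rec n

lemma cmc_sum (N : ℕ) : ∑ n ∈ Finset.range N, (n : ℝ) * cubicMapCount n * (2 / 27) ^ n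
    ≤ 1 - ((N : ℝ) + 1) * (2 * N + 1) * (cubicMapCount N * (2 / 27) ^ N) := by
  induction N with
  | zero => simp [cubicMapCount]
  | succ N ih =>
    rw [Finset.sum_range_succ]
    have h := cmc_succ N
    have h0 := cmc_nonneg N
    push_cast
    linarith

lemma cmc_lower (n : ℕ) : 4 / 9 ≤
    ((n : ℝ) + 1) * (n + 2) * (2 * n + 3) * (cubicMapCount (n + 1) * (2 / 27) ^ (n + 1)) := by
  induction n with
  | zero => norm_num [cubicMapCount, Nat.factorial]
  | succ n ih =>
    have h := cmc_succ (n + 1)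
    have h0 := cmc_nonneg (n + 1)
    generalize cubicMapCount (n + 1 + 1) * (2 / 27) ^ (n + 1 + 1) = y at *
    generalize cubicMapCount (n + 1) * (2 / 27) ^ (n + 1) = x at *
    push_cast at *
    have hn : (0 : ℝ) ≤ n := by positivity
    have : 0 ≤ ((n : ℝ) + 2) * (n + 1 + 4 / 9) * x := by positivity
    have h2 := congrArg (fun z => ((n : ℝ) + 2) * z) h
    linarith

theorem genus_moments_at_criticality :
    Summable (fun n : ℕ => (n : ℝ) * cubicMapCount n * (2 / 27) ^ n) ∧
    ¬ Summable (fun n : ℕ => (n : ℝ) ^ 2 * cubicMapCount n * (2 / 27) ^ n) := by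
  constructor
  · refine summable_of_sum_range_le (c := 1) ?_ ?_
    · intro n
      rw [mul_assoc]
      exact mul_nonneg (by positivity) (cmc_nonneg n)
    · intro N
      have h := cmc_sum N
      have : 0 ≤ ((N : ℝ) + 1) * (2 * N + 1) * (cubicMapCount N * (2 / 27) ^ N) :=
        mul_nonneg (by positivity) (cmc_nonneg N)
      linarith
  · intro hs
    have key : Summable (fun n : ℕ => (2 / 27 : ℝ) * (1 / (n : ℝ))) := by
      refine Summable.of_nonneg_of_le (fun n => by positivity) ?_ hs
      intro n
      rcases n with _ | n
      · simp
      · have h := cmc_lower n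
        have h0 := cmc_nonneg (n + 1)
        rw [mul_assoc]
        generalize cubicMapCount (n + 1) * (2 / 27) ^ (n + 1) = x at *
        push_cast
        have hn : (0 : ℝ) ≤ n := by positivity
        rw [mul_one_div, div_le_iff₀ (by positivity)]
        have : 0 ≤ ((n : ℝ) * (n + 1) * (4 * n + 5)) * x := by positivity
        linarith
    rw [summable_mul_left_iff (by norm_num)] at key
    exact Real.not_summable_one_div_natCast key
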